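/- Let Γ be an abelian group and let χ : Γ × Γ → ℤ be biadditive and antisymmetric, i.e., χ(v+v′, w) = χ(v,w)+χ(v′,w), χ(v, w+w′) = χ(v,w)+χ(v,w′), and χ(v,w) = −χ(w,v) for all v, v′, w, w′ ∈ Γ. Let C be the free module over the dual numbers ℚ[ε]/(ε²) with basis {c_v : v ∈ Γ}, equipped with the bilinear product c_v ∗ c_w = (−1)^{χ(v,w)} c_{v+w} and the bilinear bracket {c_v, c_w} = (−1)^{χ(v,w)} χ(v,w) c_{v+w}. Then (C, ∗) is a commutative, associative, unital ℚ[ε]/(ε²)-algebra with unit c_0, and the bracket makes (C, ∗, {,}) a Poisson algebra: {,} is antisymmetric, satisfies the Jacobi identity, and satisfies the Leibniz rule {a, b ∗ c} = {a, b} ∗ c + b ∗ {a, c} for all a, b, c ∈ C. -/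

import Mathlib

/-!
STATEMENT 5: Let `Γ` be an abelian group and `χ : Γ × Γ → ℤ` biadditive and
antisymmetric.  On the free `ℚ[ε]/(ε²)`-module `C` with basis `{c_v : v ∈ Γ}`
(modelled as `Γ →₀ ℚ[ε]`, with `c_v = single v 1`), the bilinear product
`c_v ∗ c_w = (-1)^(χ v w) c_(v+w)` and bilinear bracket
`{c_v, c_w} = (-1)^(χ v w) (χ v w) c_(v+w)` make `C` a commutative associative
unital `ℚ[ε]`-algebra with unit `c_0`, and a Poisson algebra: the bracket is
antisymmetric, satisfies Jacobi, and the Leibniz rule.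
-/

open DualNumber

/-- The bilinear extension of `c_v ∗ c_w = (-1)^(χ v w) c_(v+w)`. -/
noncomputable def hallMul {Γ : Type*} [AddCommGroup Γ] (χ : Γ → Γ → ℤ)
    (a b : Γ →₀ DualNumber ℚ) : Γ →₀ DualNumber ℚ :=
  a.sum fun v x => b.sum fun w y =>
    Finsupp.single (v + w) (((-1 : ℚ) ^ χ v w) • (x * y))

/-- The bilinear extension of `{c_v, c_w} = (-1)^(χ v w) (χ v w) c_(v+w)`. -/
noncomputable def hallBracket {Γ : Type*} [AddCommGroup Γ] (χ : Γ → Γ → ℤ)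
    (a b : Γ →₀ DualNumber ℚ) : Γ →₀ DualNumber ℚ :=
  a.sum fun v x => b.sum fun w y =>
    Finsupp.single (v + w) ((((-1 : ℚ) ^ χ v w) * (χ v w : ℚ)) • (x * y))

noncomputable def twMul {Γ : Type*} [AddCommGroup Γ] (f : Γ → Γ → ℚ)
    (a b : Γ →₀ DualNumber ℚ) : Γ →₀ DualNumber ℚ :=
  a.sum fun v x => b.sum fun w y => Finsupp.single (v + w) (f v w • (x * y))

section tw
variable {Γ : Type*} [AddCommGroup Γ] (f : Γ → Γ → ℚ)

theorem twMul_single (v w : Γ) (x y : DualNumber ℚ) :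
    twMul f (Finsupp.single v x) (Finsupp.single w y) =
      Finsupp.single (v + w) (f v w • (x * y)) := by
  unfold twMul
  rw [Finsupp.sum_single_index, Finsupp.sum_single_index] <;> simp

theorem twMul_zero_left (b : Γ →₀ DualNumber ℚ) : twMul f 0 b = 0 := by
  simp [twMul]

theorem twMul_zero_right (b : Γ →₀ DualNumber ℚ) : twMul f b 0 = 0 := by
  simp [twMul]

theorem twMul_add_left (a a' b : Γ →₀ DualNumber ℚ) :
    twMul f (a + a') b = twMul f a b + twMul f a' b := by
  classical
  unfold twMul
  rw [Finsupp.sum_add_index']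
  · intro v; simp
  · intro v x y
    rw [← Finsupp.sum_add]
    simp only [add_mul, smul_add, Finsupp.single_add]

theorem twMul_add_right (a b b' : Γ →₀ DualNumber ℚ) :
    twMul f a (b + b') = twMul f a b + twMul f a b' := by
  classical
  unfold twMul
  rw [← Finsupp.sum_add]
  congr 1
  funext v x
  rw [Finsupp.sum_add_index']
  · intro v; simp
  · intro v x y
    simp only [mul_add, smul_add, Finsupp.single_add]

theorem twMul_smul_left (t : DualNumber ℚ) (a b : Γ →₀ DualNumber ℚ) :
    twMul f (t • a) b = t • twMul f a b := by
  induction a using Finsupp.induction_linear with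
  | zero => simp [twMul_zero_left]
  | add a a' h h' => simp only [smul_add, twMul_add_left, h, h']
  | single v x =>
    induction b using Finsupp.induction_linear with
    | zero => simp [twMul_zero_right]
    | add a a' h h' => simp only [smul_add, twMul_add_right, h, h']
    | single w y =>
      simp only [Finsupp.smul_single, twMul_single, smul_eq_mul, mul_smul_comm, mul_assoc]

theorem twMul_smul_right (t : DualNumber ℚ) (a b : Γ →₀ DualNumber ℚ) :
    twMul f a (t • b) = t • twMul f a b := by
  induction a using Finsupp.induction_linear with
  | zero => simp [twMul_zero_left]
  | add a a' h h' => simp only [smul_add, twMul_add_left, h, h']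
  | single v x =>
    induction b using Finsupp.induction_linear with
    | zero => simp [twMul_zero_right]
    | add a a' h h' => simp only [smul_add, twMul_add_right, h, h']
    | single w y =>
      simp only [Finsupp.smul_single, twMul_single, smul_eq_mul, mul_smul_comm, mul_left_comm]

/-- Two-variable induction. -/
theorem tw_ind2 {P : (Γ →₀ DualNumber ℚ) → (Γ →₀ DualNumber ℚ) → Prop}
    (h0 : ∀ b, P 0 b) (h0' : ∀ a, P a 0)
    (h1 : ∀ a a' b, P a b → P a' b → P (a + a') b)
    (h2 : ∀ a b b', P a b → P a b' → P a (b + b'))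
    (hs : ∀ v x w y, P (Finsupp.single v x) (Finsupp.single w y)) (a b) : P a b := by
  induction a using Finsupp.induction_linear with
  | zero => exact h0 b
  | add a a' h h' => exact h1 _ _ _ h h'
  | single v x =>
    induction b using Finsupp.induction_linear with
    | zero => exact h0' _
    | add a a' h h' => exact h2 _ _ _ h h'
    | single w y => exact hs _ _ _ _

/-- Vanishing of a triadditive function from vanishing on generators. -/
theorem tw_ind3
    {F : (Γ →₀ DualNumber ℚ) → (Γ →₀ DualNumber ℚ) → (Γ →₀ DualNumber ℚ) → (Γ →₀ DualNumber ℚ)}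
    (h1 : ∀ a a' b c, F (a + a') b c = F a b c + F a' b c)
    (h2 : ∀ a b b' c, F a (b + b') c = F a b c + F a b' c)
    (h3 : ∀ a b c c', F a b (c + c') = F a b c + F a b c')
    (hs : ∀ v x w y u z, F (Finsupp.single v x) (Finsupp.single w y) (Finsupp.single u z) = 0)
    (a b c) : F a b c = 0 := by
  induction a using Finsupp.induction_linear with
  | zero => simpa using h1 0 0 b c
  | add a a' h h' => rw [h1, h, h', add_zero]
  | single v x =>
    induction b using Finsupp.induction_linear with
    | zero => simpa using h2 (Finsupp.single v x) 0 0 c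
    | add a a' h h' => rw [h2, h, h', add_zero]
    | single w y =>
      induction c using Finsupp.induction_linear with
      | zero => simpa using h3 (Finsupp.single v x) (Finsupp.single w y) 0 0
      | add a a' h h' => rw [h3, h, h', add_zero]
      | single u z => exact hs _ _ _ _ _ _

end tw

theorem neg_one_zpow_neg_q (n : ℤ) : (-1 : ℚ) ^ (-n) = (-1) ^ n := by
  rw [zpow_neg, ← inv_zpow]; norm_num

theorem hallMul_hallBracket_poisson_algebra
    {Γ : Type*} [AddCommGroup Γ] (χ : Γ → Γ → ℤ)
    (hχadd_left : ∀ v v' w : Γ, χ (v + v') w = χ v w + χ v' w)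
    (hχadd_right : ∀ v w w' : Γ, χ v (w + w') = χ v w + χ v w')
    (hχanti : ∀ v w : Γ, χ v w = -χ w v) :
    -- values on basis elements:
    (∀ v w : Γ, hallMul χ (Finsupp.single v 1) (Finsupp.single w 1) =
      Finsupp.single (v + w) (((-1 : ℚ) ^ χ v w) • (1 : DualNumber ℚ))) ∧
    (∀ v w : Γ, hallBracket χ (Finsupp.single v 1) (Finsupp.single w 1) =
      Finsupp.single (v + w) ((((-1 : ℚ) ^ χ v w) * (χ v w : ℚ)) • (1 : DualNumber ℚ))) ∧
    -- `∗` is `ℚ[ε]`-bilinear: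
    (∀ a a' b : Γ →₀ DualNumber ℚ, hallMul χ (a + a') b = hallMul χ a b + hallMul χ a' b) ∧
    (∀ a b b' : Γ →₀ DualNumber ℚ, hallMul χ a (b + b') = hallMul χ a b + hallMul χ a b') ∧
    (∀ (t : DualNumber ℚ) (a b : Γ →₀ DualNumber ℚ),
      hallMul χ (t • a) b = t • hallMul χ a b) ∧
    (∀ (t : DualNumber ℚ) (a b : Γ →₀ DualNumber ℚ),
      hallMul χ a (t • b) = t • hallMul χ a b) ∧
    -- `∗` is commutative, associative, with unit `c_0`:
    (∀ a b : Γ →₀ DualNumber ℚ, hallMul χ a b = hallMul χ b a) ∧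
    (∀ a b c : Γ →₀ DualNumber ℚ,
      hallMul χ (hallMul χ a b) c = hallMul χ a (hallMul χ b c)) ∧
    (∀ a : Γ →₀ DualNumber ℚ, hallMul χ (Finsupp.single 0 1) a = a) ∧
    (∀ a : Γ →₀ DualNumber ℚ, hallMul χ a (Finsupp.single 0 1) = a) ∧
    -- the bracket is `ℚ[ε]`-bilinear:
    (∀ a a' b : Γ →₀ DualNumber ℚ,
      hallBracket χ (a + a') b = hallBracket χ a b + hallBracket χ a' b) ∧
    (∀ a b b' : Γ →₀ DualNumber ℚ,
      hallBracket χ a (b + b') = hallBracket χ a b + hallBracket χ a b') ∧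
    (∀ (t : DualNumber ℚ) (a b : Γ →₀ DualNumber ℚ),
      hallBracket χ (t • a) b = t • hallBracket χ a b) ∧
    (∀ (t : DualNumber ℚ) (a b : Γ →₀ DualNumber ℚ),
      hallBracket χ a (t • b) = t • hallBracket χ a b) ∧
    -- the bracket is antisymmetric:
    (∀ a b : Γ →₀ DualNumber ℚ, hallBracket χ a b = -hallBracket χ b a) ∧
    -- Jacobi identity:
    (∀ a b c : Γ →₀ DualNumber ℚ,
      hallBracket χ a (hallBracket χ b c) + hallBracket χ b (hallBracket χ c a) +
        hallBracket χ c (hallBracket χ a b) = 0) ∧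
    -- Leibniz rule:
    (∀ a b c : Γ →₀ DualNumber ℚ,
      hallBracket χ a (hallMul χ b c) =
        hallMul χ (hallBracket χ a b) c + hallMul χ b (hallBracket χ a c)) := by
  have e1 : hallMul χ = twMul (fun v w => (-1 : ℚ) ^ χ v w) := rfl
  have e2 : hallBracket χ = twMul (fun v w => (-1 : ℚ) ^ χ v w * (χ v w : ℚ)) := rfl
  have h0l : ∀ v, χ 0 v = 0 := fun v => by simpa using hχadd_left 0 0 v
  have h0r : ∀ v, χ v 0 = 0 := fun v => by simpa using hχadd_right v 0 0
  have en : (-1 : ℚ) ≠ 0 := by norm_num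
  rw [e1, e2]
  have comm : ∀ a b : Γ →₀ DualNumber ℚ, twMul (fun v w => (-1 : ℚ) ^ χ v w) a b =
      twMul (fun v w => (-1 : ℚ) ^ χ v w) b a := by
    refine tw_ind2 ?_ ?_ ?_ ?_ ?_
    · intro b; rw [twMul_zero_left, twMul_zero_right]
    · intro b; rw [twMul_zero_left, twMul_zero_right]
    · intro a a' b h h'; rw [twMul_add_left, twMul_add_right, h, h']
    · intro a a' b h h'; rw [twMul_add_left, twMul_add_right, h, h']
    · intro v x w y
      rw [twMul_single, twMul_single, add_comm v w, mul_comm x y, hχanti v w, neg_one_zpow_neg_q]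
  have unit : ∀ a : Γ →₀ DualNumber ℚ,
      twMul (fun v w => (-1 : ℚ) ^ χ v w) (Finsupp.single 0 1) a = a := by
    intro a
    induction a using Finsupp.induction_linear with
    | zero => rw [twMul_zero_right]
    | add a a' h h' => rw [twMul_add_right, h, h']
    | single v x => rw [twMul_single, h0l]; simp
  refine ⟨?_, ?_, twMul_add_left _, twMul_add_right _, twMul_smul_left _, twMul_smul_right _,
    comm, ?_, unit, fun a => (comm _ _).trans (unit a), twMul_add_left _, twMul_add_right _,
    twMul_smul_left _, twMul_smul_right _, ?_, ?_, ?_⟩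
  · intro v w; rw [twMul_single, mul_one]
  · intro v w; rw [twMul_single, mul_one]
  · intro a b c
    rw [← sub_eq_zero]
    revert a b c
    refine tw_ind3 ?_ ?_ ?_ ?_
    · intros; simp only [twMul_add_left, twMul_add_right]; abel
    · intros; simp only [twMul_add_left, twMul_add_right]; abel
    · intros; simp only [twMul_add_left, twMul_add_right]; abel
    · intro v x w y u z
      simp only [twMul_single, hχadd_left, hχadd_right, zpow_add₀ en, add_assoc]
      rw [← Finsupp.single_sub]
      simp only [smul_mul_assoc, mul_smul_comm, smul_smul, mul_assoc, ← sub_smul]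
      rw [Finsupp.single_eq_zero]
      convert zero_smul ℚ _ using 2
      ring
  · refine tw_ind2 ?_ ?_ ?_ ?_ ?_
    · intro b; rw [twMul_zero_left, twMul_zero_right, neg_zero]
    · intro b; rw [twMul_zero_left, twMul_zero_right, neg_zero]
    · intro a a' b h h'; rw [twMul_add_left, twMul_add_right, h, h', neg_add]
    · intro a a' b h h'; rw [twMul_add_left, twMul_add_right, h, h', neg_add]
    · intro v x w y
      rw [twMul_single, twMul_single, add_comm v w, mul_comm x y, hχanti v w, neg_one_zpow_neg_q,
        ← Finsupp.single_neg, ← neg_smul, Int.cast_neg, mul_neg]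
  · refine tw_ind3 ?_ ?_ ?_ ?_
    · intros; simp only [twMul_add_left, twMul_add_right]; abel
    · intros; simp only [twMul_add_left, twMul_add_right]; abel
    · intros; simp only [twMul_add_left, twMul_add_right]; abel
    · intro v x w y u z
      have g1 : w + (u + v) = v + (w + u) := by abel
      have g2 : u + (v + w) = v + (w + u) := by abel
      have m1 : y * (z * x) = x * (y * z) := by ring
      have m2 : z * (x * y) = x * (y * z) := by ring
      simp only [twMul_single, hχadd_left, hχadd_right, zpow_add₀ en, g1, g2]
      rw [← Finsupp.single_add, ← Finsupp.single_add]
      simp only [mul_smul_comm, smul_smul, m1, m2, ← add_smul]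
      rw [Finsupp.single_eq_zero]
      convert zero_smul ℚ _ using 2
      rw [hχanti w v, hχanti u v, hχanti u w]
      simp only [neg_one_zpow_neg_q]
      push_cast
      ring
  · intro a b c
    rw [← sub_eq_zero]
    revert a b c
    refine tw_ind3 ?_ ?_ ?_ ?_
    · intros; simp only [twMul_add_left, twMul_add_right]; abel
    · intros; simp only [twMul_add_left, twMul_add_right]; abel
    · intros; simp only [twMul_add_left, twMul_add_right]; abel
    · intro v x w y u z
      have g1 : w + (v + u) = v + (w + u) := by abel
      have m1 : y * (x * z) = x * (y * z) := by ring
      simp only [twMul_single, hχadd_left, hχadd_right, zpow_add₀ en, add_assoc, g1]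
      rw [← Finsupp.single_add, ← Finsupp.single_sub]
      simp only [smul_mul_assoc, mul_smul_comm, smul_smul, mul_assoc, m1, ← add_smul, ← sub_smul]
      rw [Finsupp.single_eq_zero]
      convert zero_smul ℚ _ using 2
      rw [hχanti w v]
      simp only [neg_one_zpow_neg_q]
      push_cast
      ring
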